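/- arXiv:1705.10592 — 2 statements merged into one kernel-verified Lean document; each statement's English description precedes it below -/
import Mathlib

section
/- Let q be a prime power, M, n, ℓ ≥ 1 and t, ρ, μ ≥ 0 integers with 2t + ρ ≤ n and μ ≤ n. Let (C_S) be a coset coding scheme with message set F_q^{M×ℓ} and codeword set F_q^{M×n}. If the scheme is crisscross t-error and ρ-erasure-correcting and secure under μ column-observations, then ℓ + 2t + ρ + μ ≤ n. -/
open Matrix

/-- The crisscross weight of a matrix: the minimum size `#X + #Y` of a cover `(X, Y)`
by rows `X` and columns `Y` of all nonzero entries. -/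
noncomputable def wtc {K : Type*} [Zero K] {M N : ℕ} (E : Matrix (Fin M) (Fin N) K) : ℕ :=
  sInf {k | ∃ (X : Finset (Fin M)) (Y : Finset (Fin N)),
    (∀ i j, E i j ≠ 0 → i ∈ X ∨ j ∈ Y) ∧ X.card + Y.card = k}

/-- `colSel I h C = C P_Iᵀ`: the submatrix of the columns of `C` indexed by `I`
(in increasing order). -/
def colSel {K : Type*} {M n d : ℕ} (I : Finset (Fin n)) (h : I.card = d)
    (C : Matrix (Fin M) (Fin n) K) : Matrix (Fin M) (Fin d) K :=
  C.submatrix id (fun j => (I.orderIsoOfFin h j : Fin n))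

/-- A coset coding scheme is crisscross `t`-error and `ρ`-erasure-correcting. -/
def CrissCorrecting {K : Type*} [Field K] {M n ℓ : ℕ} (t ρ : ℕ)
    (CS : Matrix (Fin M) (Fin ℓ) K → Set (Matrix (Fin M) (Fin n) K)) : Prop :=
  ∀ (I : Finset (Fin n)) (h : I.card = n - ρ),
    ∃ D : Matrix (Fin M) (Fin (n - ρ)) K → Matrix (Fin M) (Fin ℓ) K,
      ∀ S C E, C ∈ CS S → wtc E ≤ t → D (colSel I h C + E) = S

/-- A coset coding scheme is secure under `μ` column-observations. -/
def ColSecure {K : Type*} [Field K] {M n ℓ : ℕ} (μ : ℕ)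
    (CS : Matrix (Fin M) (Fin ℓ) K → Set (Matrix (Fin M) (Fin n) K)) : Prop :=
  ∀ (J : Finset (Fin n)) (h : J.card = μ) (S₁ S₂ : Matrix (Fin M) (Fin ℓ) K)
    (W : Matrix (Fin M) (Fin μ) K),
    ({X ∈ CS S₁ | colSel J h X = W}).ncard * (CS S₂).ncard
      = ({X ∈ CS S₂ | colSel J h X = W}).ncard * (CS S₁).ncard

/-- Preprocessing functions `EI i` (applied to the columns of `C` indexed by `I`, plus
errors) are `t`-crisscross-error-correcting with respect to the coset coding scheme. -/
def CrissPreproc {K : Type*} [Field K] {M n ℓ d : ℕ} (t : ℕ)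
    (I : Finset (Fin n)) (hI : I.card = d) {b : Fin d → ℕ}
    (EI : ∀ i : Fin d, (Fin M → K) → (Fin (b i) → K))
    (CS : Matrix (Fin M) (Fin ℓ) K → Set (Matrix (Fin M) (Fin n) K)) : Prop :=
  ∃ D : (∀ i : Fin d, Fin (b i) → K) → Matrix (Fin M) (Fin ℓ) K,
    ∀ S C E, C ∈ CS S → wtc E ≤ t →
      D (fun i => EI i (fun r => C r (I.orderIsoOfFin hI i : Fin n) + E r i)) = S

/-- A matrix supported on the columns in `Y` has crisscross weight at most `#Y`. -/
lemma wtc_le_card {K : Type*} [Zero K] {M N : ℕ} (E : Matrix (Fin M) (Fin N) K)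
    (Y : Finset (Fin N)) (hY : ∀ i j, E i j ≠ 0 → j ∈ Y) : wtc E ≤ Y.card :=
  Nat.sInf_le ⟨∅, Y, fun i j h => Or.inr (hY i j h), by simp⟩

/-- A matrix supported on `t` consecutive columns has crisscross weight at most `t`. -/
lemma wtc_le_of_support_window {K : Type*} [Zero K] {M N : ℕ} (E : Matrix (Fin M) (Fin N) K)
    (a t : ℕ) (hE : ∀ i j, E i j ≠ 0 → a ≤ (j : ℕ) ∧ (j : ℕ) < a + t) : wtc E ≤ t := by
  refine (wtc_le_card E {j | a ≤ (j : ℕ) ∧ (j : ℕ) < a + t} (by simpa using hE)).trans ?_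
  rw [← Finset.card_map Fin.valEmbedding]
  refine (Finset.card_le_card (t := Finset.Ico a (a + t)) fun x hx => ?_).trans (by simp)
  simp only [Finset.mem_map, Finset.mem_filter, Finset.mem_univ, true_and] at hx
  obtain ⟨j, hj, rfl⟩ := hx
  simpa using hj

/-- The set of the first `d` columns. -/
def firstCols {d n : ℕ} (h : d ≤ n) : Finset (Fin n) :=
  Finset.univ.map (Fin.castLEEmb h)

lemma card_firstCols {d n : ℕ} (h : d ≤ n) : (firstCols h).card = d := by
  simp [firstCols]

lemma colSel_firstCols {K : Type*} {M d n : ℕ} (h : d ≤ n) (C : Matrix (Fin M) (Fin n) K)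
    (i : Fin M) (j : Fin d) :
    colSel (firstCols h) (card_firstCols h) C i j = C i (Fin.castLE h j) := by
  have := congrFun (Finset.orderEmbOfFin_unique (card_firstCols h) (f := Fin.castLE h)
    (by simp [firstCols]) (Fin.strictMono_castLE h)) j
  rw [this]
  rfl

/-- In a correcting scheme, the first `n - ρ - 2t` columns determine the message. -/
lemma CrissCorrecting.message_eq {K : Type*} [Field K] {M n ℓ t ρ : ℕ}
    {CS : Matrix (Fin M) (Fin ℓ) K → Set (Matrix (Fin M) (Fin n) K)}
    (hcorr : CrissCorrecting t ρ CS) {S₁ S₂ : Matrix (Fin M) (Fin ℓ) K}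
    {C₁ C₂ : Matrix (Fin M) (Fin n) K} (h₁ : C₁ ∈ CS S₁) (h₂ : C₂ ∈ CS S₂)
    (hC : ∀ i (j : Fin n), (j : ℕ) < n - ρ - 2 * t → C₁ i j = C₂ i j) : S₁ = S₂ := by
  have hle : n - ρ ≤ n := Nat.sub_le n ρ
  obtain ⟨D, hD⟩ := hcorr (firstCols hle) (card_firstCols hle)
  let c := Fin.castLE hle
  let m := n - ρ - 2 * t
  let E₁ : Matrix (Fin M) (Fin (n - ρ)) K := fun i j =>
    if (j : ℕ) < m + t then C₂ i (c j) - C₁ i (c j) else 0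
  let E₂ : Matrix (Fin M) (Fin (n - ρ)) K := fun i j =>
    if (j : ℕ) < m + t then 0 else C₁ i (c j) - C₂ i (c j)
  have hE₁ : wtc E₁ ≤ t := by
    refine wtc_le_of_support_window E₁ m t fun i j hij => ?_
    by_contra hj
    apply hij
    simp only [E₁]
    split_ifs with hlt
    · rw [hC i (c j) (by simp only [c, Fin.val_castLE]; omega), sub_self]
    · rfl
  have hE₂ : wtc E₂ ≤ t := by
    refine wtc_le_of_support_window E₂ (m + t) t fun i j hij => ?_
    by_contra hj
    apply hij
    simp only [E₂]
    split_ifs with hlt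
    · rfl
    · have := j.isLt
      omega
  have hsum : colSel (firstCols hle) (card_firstCols hle) C₁ + E₁
      = colSel (firstCols hle) (card_firstCols hle) C₂ + E₂ := by
    ext i j
    rw [Matrix.add_apply, Matrix.add_apply, colSel_firstCols, colSel_firstCols]
    simp only [E₁, E₂, c]
    split_ifs <;> ring
  rw [← hD S₁ C₁ E₁ h₁ hE₁, hsum, hD S₂ C₂ E₂ h₂ hE₂]

/-- In a secure scheme, any observation of `μ` columns of a codeword is consistent with
every message. -/
lemma ColSecure.exists_colSel_eq {K : Type*} [Field K] [Finite K] {M n ℓ μ : ℕ}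
    {CS : Matrix (Fin M) (Fin ℓ) K → Set (Matrix (Fin M) (Fin n) K)}
    (hsec : ColSecure μ CS) (hne : ∀ S, (CS S).Nonempty)
    (J : Finset (Fin n)) (h : J.card = μ) {S₀ : Matrix (Fin M) (Fin ℓ) K}
    {C₀ : Matrix (Fin M) (Fin n) K} (hC₀ : C₀ ∈ CS S₀) (S : Matrix (Fin M) (Fin ℓ) K) :
    ∃ X ∈ CS S, colSel J h X = colSel J h C₀ := by
  have hfin (s : Set (Matrix (Fin M) (Fin n) K)) : s.Finite := Set.toFinite s
  have hpos : 0 < ({X ∈ CS S₀ | colSel J h X = colSel J h C₀}).ncard * (CS S).ncard :=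
    Nat.mul_pos ((Set.ncard_pos (hfin _)).2 ⟨C₀, hC₀, rfl⟩) ((Set.ncard_pos (hfin _)).2 (hne S))
  rw [hsec J h S₀ S] at hpos
  obtain ⟨X, hX, hXJ⟩ := (Set.ncard_pos (hfin _)).1 (Nat.pos_of_mul_pos_right hpos)
  exact ⟨X, hX, hXJ⟩

/-- the information-rate bound `ℓ + 2t + ρ + μ ≤ n` for crisscross-correcting,
column-secure coset coding schemes. -/
theorem stmt14 {Fq : Type*} [Field Fq] [Fintype Fq]
    (q M n ℓ t ρ μ : ℕ) (hq : IsPrimePow q) (hcq : Fintype.card Fq = q)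
    (hM : 0 < M) (hn : 0 < n) (hℓ : 0 < ℓ) (htρ : 2 * t + ρ ≤ n) (hμ : μ ≤ n)
    (CS : Matrix (Fin M) (Fin ℓ) Fq → Set (Matrix (Fin M) (Fin n) Fq))
    (hne : ∀ S, (CS S).Nonempty)
    (hdisj : ∀ S T, S ≠ T → Disjoint (CS S) (CS T))
    (hcorr : CrissCorrecting t ρ CS)
    (hsec : ColSecure μ CS) :
    ℓ + 2 * t + ρ + μ ≤ n := by
  obtain ⟨C₀, hC₀⟩ := hne 0
  choose X hX hXJ using
    hsec.exists_colSel_eq hne (firstCols hμ) (card_firstCols hμ) hC₀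
  let m := n - ρ - 2 * t
  let f : Matrix (Fin M) (Fin ℓ) Fq → Matrix (Fin M) (Fin (m - μ)) Fq :=
    fun S i j => X S i ⟨μ + j, by have := j.isLt; omega⟩
  have hf : Function.Injective f := by
    intro S T hST
    refine hcorr.message_eq (hX S) (hX T) fun i j hj => ?_
    by_cases hjμ : (j : ℕ) < μ
    · have := congrFun (congrFun ((hXJ S).trans (hXJ T).symm) i) ⟨j, hjμ⟩
      simpa only [colSel_firstCols, Fin.castLE_mk, Fin.eta] using this
    · have := congrFun (congrFun hST i) ⟨j - μ, by omega⟩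
      simpa only [f, Nat.add_sub_of_le (not_lt.1 hjμ), Fin.eta] using this
  have hcard : Nat.card (Fin M → Fin ℓ → Fq) ≤ Nat.card (Fin M → Fin (m - μ) → Fq) :=
    Nat.card_le_card_of_injective f hf
  simp only [Nat.card_fun, Nat.card_fin, ← pow_mul] at hcard
  have hle := (Nat.pow_le_pow_iff_right Finite.one_lt_card).1 hcard
  have := Nat.le_of_mul_le_mul_right hle hM
  omega
end

section
/- Let q be a prime power, M, n, ℓ, d ≥ 1 and t, μ ≥ 0 integers with 2t + μ < d and d ≤ n. Let (C_S) be a coset coding scheme with message set F_q^{M×ℓ} and codeword set F_q^{M×n} that is secure under μ column-observations. Let I ⊆ {1,…,n} with #I = d, and let E_{I,i} : F_q^M → F_q^{b_i} (i = 1,…,d) be preprocessing functions that are t-crisscross-error-correcting with respect to the scheme on the column set I. Then (Σ_{i=1}^d b_i) · (d − 2t − μ) ≥ M · ℓ · d; equivalently, the communication overhead satisfies CO(I) = (Σ_{i=1}^d b_i)/M − ℓ ≥ ℓ(2t + μ)/(d − 2t − μ). -/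
open Matrix

/-- A matrix supported on the columns in `Y` has crisscross weight at most `#Y`. -/
theorem wtc_le_card_of_columns {K : Type*} [Zero K] {M N : ℕ} (E : Matrix (Fin M) (Fin N) K)
    (Y : Finset (Fin N)) (h : ∀ i j, j ∉ Y → E i j = 0) : wtc E ≤ Y.card := by
  refine Nat.sInf_le ⟨∅, Y, fun i j hij => Or.inr ?_, by simp⟩
  by_contra hj
  exact hij (h i j hj)

/-- Equality of the selected submatrices means equality of the selected columns. -/
theorem eq_of_colSel_eq {K : Type*} {M n d : ℕ} {I : Finset (Fin n)} {h : I.card = d}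
    {C C' : Matrix (Fin M) (Fin n) K} (hC : colSel I h C = colSel I h C')
    {j : Fin n} (hj : j ∈ I) (r : Fin M) : C r j = C' r j := by
  have := congrFun (congrFun hC r) ((I.orderIsoOfFin h).symm ⟨j, hj⟩)
  simpa only [colSel, Matrix.submatrix_apply, id_eq, OrderIso.apply_symm_apply] using this

/-- In a column-secure scheme every observation of one codeword set occurs in all others. -/
theorem ColSecure.exists_mem {K : Type*} [Field K] [Finite K] {M n ℓ μ : ℕ}
    {CS : Matrix (Fin M) (Fin ℓ) K → Set (Matrix (Fin M) (Fin n) K)}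
    (hsec : ColSecure μ CS) (hne : ∀ S, (CS S).Nonempty)
    (J : Finset (Fin n)) (h : J.card = μ) {S₀ : Matrix (Fin M) (Fin ℓ) K}
    {C₀ : Matrix (Fin M) (Fin n) K} (hC₀ : C₀ ∈ CS S₀) (S : Matrix (Fin M) (Fin ℓ) K) :
    ∃ C ∈ CS S, colSel J h C = colSel J h C₀ := by
  have hfin (A : Set (Matrix (Fin M) (Fin n) K)) : A.Finite :=
    have : Finite (Matrix (Fin M) (Fin n) K) := inferInstanceAs (Finite (Fin M → Fin n → K))
    A.toFinite
  have hpos : 0 < ({X ∈ CS S₀ | colSel J h X = colSel J h C₀}).ncard * (CS S).ncard :=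
    Nat.mul_pos ((Set.ncard_pos (hfin _)).2 ⟨C₀, hC₀, rfl⟩) ((Set.ncard_pos (hfin _)).2 (hne S))
  rw [hsec J h S₀ S] at hpos
  obtain ⟨C, hC, hW⟩ := (Set.ncard_pos (hfin _)).1 (Nat.pos_of_mul_pos_right hpos)
  exact ⟨C, hC, hW⟩

/-- The preprocessed columns outside two sets of at most `t` columns determine the message. -/
theorem CrissPreproc.message_eq {K : Type*} [Field K] {M n ℓ d t : ℕ}
    {I : Finset (Fin n)} {hI : I.card = d} {b : Fin d → ℕ}
    {EI : ∀ i : Fin d, (Fin M → K) → (Fin (b i) → K)}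
    {CS : Matrix (Fin M) (Fin ℓ) K → Set (Matrix (Fin M) (Fin n) K)}
    (hEI : CrissPreproc t I hI EI CS) {A B : Finset (Fin d)} (hA : A.card ≤ t) (hB : B.card ≤ t)
    {S S' : Matrix (Fin M) (Fin ℓ) K} {C C' : Matrix (Fin M) (Fin n) K}
    (hC : C ∈ CS S) (hC' : C' ∈ CS S')
    (heq : ∀ i, i ∉ A → i ∉ B →
      EI i (fun r => C r (I.orderIsoOfFin hI i)) = EI i (fun r => C' r (I.orderIsoOfFin hI i))) :
    S = S' := by
  classical
  obtain ⟨D, hD⟩ := hEI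
  let Δ : Matrix (Fin M) (Fin d) K := colSel I hI C' - colSel I hI C
  let E : Matrix (Fin M) (Fin d) K := fun r i => if i ∈ A then Δ r i else 0
  let E' : Matrix (Fin M) (Fin d) K := fun r i => if i ∈ B \ A then -Δ r i else 0
  have hE : wtc E ≤ t :=
    (wtc_le_card_of_columns E A fun r i hi => if_neg hi).trans hA
  have hE' : wtc E' ≤ t :=
    (wtc_le_card_of_columns E' (B \ A) fun r i hi => if_neg hi).trans
      ((Finset.card_le_card Finset.sdiff_subset).trans hB)
  rw [← hD S C E hC hE, ← hD S' C' E' hC' hE']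
  congr 1
  funext i
  by_cases hiA : i ∈ A
  · simp [E, E', Δ, hiA, colSel]
  by_cases hiB : i ∈ B
  · simp [E, E', Δ, hiA, hiB, colSel]
  · simpa [E, E', hiA, hiB] using heq i hiA hiB

/-- Averaging over cyclic shifts: if every `k`-subset has weight at least `m`, then
the total weight is at least `m * d / k`. -/
theorem mul_le_sum_mul_of_forall_card_eq {d k m : ℕ} (hk : k ≤ d) (b : Fin d → ℕ)
    (h : ∀ U : Finset (Fin d), U.card = k → m ≤ ∑ i ∈ U, b i) :
    m * d ≤ (∑ i, b i) * k := by
  rcases Nat.eq_zero_or_pos d with rfl | hd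
  · simp
  have : NeZero d := ⟨hd.ne'⟩
  obtain ⟨V, -, hV⟩ := Finset.exists_subset_card_eq
    (show k ≤ (Finset.univ : Finset (Fin d)).card by simpa using hk)
  calc m * d = ∑ _s : Fin d, m := by simp [mul_comm]
    _ ≤ ∑ s : Fin d, ∑ i ∈ V, b (i + s) := by
      refine Finset.sum_le_sum fun s _ => ?_
      simpa using h (V.map (Equiv.addRight s).toEmbedding) (by simpa using hV)
    _ = ∑ i ∈ V, ∑ s : Fin d, b (i + s) := Finset.sum_comm
    _ = ∑ _i ∈ V, ∑ s, b s :=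
      Finset.sum_congr rfl fun i _ => Equiv.sum_comp (Equiv.addLeft i) b
    _ = (∑ i, b i) * k := by simp [hV, mul_comm]

/-- the communication-overhead lower bound
`(∑ i, b i) * (d - 2t - μ) ≥ M * ℓ * d`, i.e. `CO(I) ≥ ℓ(2t+μ)/(d-2t-μ)`,
for `t`-crisscross-error-correcting preprocessing functions on a column set `I`. -/
theorem stmt15 {Fq : Type*} [Field Fq] [Fintype Fq]
    (q M n ℓ d t μ : ℕ) (hq : IsPrimePow q) (hcq : Fintype.card Fq = q)
    (hM : 0 < M) (hn : 0 < n) (hℓ : 0 < ℓ) (hd : 0 < d) (hdn : d ≤ n)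
    (htμ : 2 * t + μ < d)
    (CS : Matrix (Fin M) (Fin ℓ) Fq → Set (Matrix (Fin M) (Fin n) Fq))
    (hne : ∀ S, (CS S).Nonempty)
    (hdisj : ∀ S T, S ≠ T → Disjoint (CS S) (CS T))
    (hsec : ColSecure μ CS)
    (I : Finset (Fin n)) (hI : I.card = d)
    (b : Fin d → ℕ) (hb : ∀ i, 1 ≤ b i)
    (EI : ∀ i : Fin d, (Fin M → Fq) → (Fin (b i) → Fq))
    (hEI : CrissPreproc t I hI EI CS) :
    M * ℓ * d ≤ (∑ i, b i) * (d - 2 * t - μ) := by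
  refine mul_le_sum_mul_of_forall_card_eq (by omega) b fun U hU => ?_
  have hUc : Uᶜ.card = 2 * t + μ := by
    rw [Finset.card_compl, Fintype.card_fin]
    omega
  obtain ⟨V, hVU, hV⟩ := Finset.exists_subset_card_eq (show μ ≤ Uᶜ.card by omega)
  have hUV : (Uᶜ \ V).card = 2 * t := by
    rw [Finset.card_sdiff_of_subset hVU]
    omega
  obtain ⟨A, hAU, hA⟩ := Finset.exists_subset_card_eq (show t ≤ (Uᶜ \ V).card by omega)
  have hB : ((Uᶜ \ V) \ A).card = t := by
    rw [Finset.card_sdiff_of_subset hAU]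
    omega
  let J : Finset (Fin n) := V.map
    ((I.orderIsoOfFin hI).toEquiv.toEmbedding.trans (Function.Embedding.subtype _))
  have hJ : J.card = μ := by simpa [J] using hV
  obtain ⟨C₀, hC₀⟩ := hne 0
  choose C hC hW using hsec.exists_mem hne J hJ hC₀
  let f : Matrix (Fin M) (Fin ℓ) Fq → ∀ i : U, Fin (b i) → Fq :=
    fun S i => EI i (fun r => C S r (I.orderIsoOfFin hI i))
  have hf : Function.Injective f := by
    intro S S' hSS
    refine hEI.message_eq hA.le hB.le (hC S) (hC S') fun i hiA hiB => ?_
    by_cases hiU : i ∈ U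
    · exact congrFun hSS ⟨i, hiU⟩
    have hiV : i ∈ V := by
      by_contra hiV
      exact hiB (by simp [hiA, hiU, hiV])
    congr 1
    funext r
    exact eq_of_colSel_eq ((hW S).trans (hW S').symm) (Finset.mem_map_of_mem _ hiV) r
  have hcard := Nat.card_le_card_of_injective f hf
  have hdom : Nat.card (Matrix (Fin M) (Fin ℓ) Fq) = Nat.card Fq ^ (M * ℓ) := by
    change Nat.card (Fin M → Fin ℓ → Fq) = _
    simp [← pow_mul, mul_comm]
  have hcod : Nat.card (∀ i : U, Fin (b i) → Fq) = Nat.card Fq ^ ∑ i ∈ U, b i := by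
    rw [Nat.card_pi, ← Finset.prod_pow_eq_pow_sum, ← Finset.prod_coe_sort U]
    simp
  rw [hdom, hcod] at hcard
  exact (Nat.pow_le_pow_iff_right Finite.one_lt_card).1 hcard
end
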